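/- arXiv:1801.03574 — 3 statements merged into one kernel-verified Lean document; each statement's English description precedes it below -/
import Mathlib

section
/- Let t ∈ I ∖ {T} and let U : Ω ⇒ ℝ^d be an F_{t+1}-measurable correspondence with convex values. Then the correspondence U^♭ is F_t-measurable and has convex values. Moreover, for every ω ∈ Ω such that U(ω̄) ≠ ∅ for all ω̄ ∈ Σ_t^ω, one has the inclusions ri U^♯(ω) ⊆ U^♭(ω) ⊆ U^♯(ω). -/
open Set MeasureTheory Pointwise

namespace MSPPaper

section Defs

variable {Ω E : Type*}

/-- A finitely supported probability measure on `Ω`: finite support, strictly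
positive weights on the support, total mass one. -/
structure FinProb (Ω : Type*) where
  supp : Finset Ω
  w : Ω → ℝ
  pos : ∀ ω ∈ supp, 0 < w ω
  zero : ∀ ω ∉ supp, w ω = 0
  sum_one : ∑ ω ∈ supp, w ω = 1

/-- The measure of a set under a finitely supported probability. -/
noncomputable def FinProb.meas (Q : FinProb Ω) (A : Set Ω) : ℝ :=
  letI := Classical.decPred fun ω => ω ∈ A
  ∑ ω ∈ Q.supp.filter (fun ω => ω ∈ A), Q.w ω

/-- The level set `Σ_t^ω` of the process `ψ`. -/
def level (ψ : ℕ → Ω → E) (t : ℕ) (ω : Ω) : Set Ω :=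
  {ω' | ∀ s ≤ t, ψ s ω' = ψ s ω}

/-- The conditional expectation `E_Q[ξ | F_t](ω)`. -/
noncomputable def condExp {F : Type*} [AddCommMonoid F] [Module ℝ F]
    (ψ : ℕ → Ω → E) (t : ℕ) (Q : FinProb Ω) (ξ : Ω → F) (ω : Ω) : F :=
  letI := Classical.decPred fun ω' => ω' ∈ level ψ t ω
  (Q.meas (level ψ t ω))⁻¹ •
    ∑ ω' ∈ Q.supp.filter (fun ω' => ω' ∈ level ψ t ω), Q.w ω' • ξ ω'

variable [MeasurableSpace E]

/-- The natural filtration `F̂_t` generated by `ψ_0, …, ψ_t`. -/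
def natFilt (ψ : ℕ → Ω → E) (t : ℕ) : MeasurableSpace Ω :=
  ⨆ s ∈ Finset.range (t + 1), MeasurableSpace.comap (ψ s) inferInstance

/-- The `P`-null sets relative to `F̂_t`. -/
def nullSets (ψ : ℕ → Ω → E) (P : FinProb Ω) (t : ℕ) : Set (Set Ω) :=
  {A | ∃ A', A ⊆ A' ∧ MeasurableSet[natFilt ψ t] A' ∧ P.meas A' = 0}

/-- The completed filtration `F_t`. -/
def filt (ψ : ℕ → Ω → E) (t : ℕ) : MeasurableSpace Ω :=
  ⨅ P : FinProb Ω,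
    MeasurableSpace.generateFrom ({A | MeasurableSet[natFilt ψ t] A} ∪ nullSets ψ P t)

/-- `G`-measurability of a correspondence. -/
def CorrMeasurable {F : Type*} [TopologicalSpace F]
    (G : MeasurableSpace Ω) (U : Ω → Set F) : Prop :=
  ∀ O : Set F, IsOpen O → MeasurableSet[G] {ω | (U ω ∩ O).Nonempty}

/-- The set `L(G; U)` of `G`-measurable selections of `U`. -/
def Selections {F : Type*} [MeasurableSpace F]
    (G : MeasurableSpace Ω) (U : Ω → Set F) : Set (Ω → F) :=
  {ξ | Measurable[G] ξ ∧ ∀ ω, ξ ω ∈ U ω}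

/-- The correspondence `U^♯` (taken at stage `t`). -/
def sharp {d : ℕ} (ψ : ℕ → Ω → E) (t : ℕ) (U : Ω → Set (Fin d → ℝ)) (ω : Ω) :
    Set (Fin d → ℝ) :=
  convexHull ℝ (⋃ ω' ∈ level ψ t ω, U ω')

/-- The correspondence `U^♭` (taken at stage `t`). -/
def flat {d : ℕ} (ψ : ℕ → Ω → E) (t : ℕ) (U : Ω → Set (Fin d → ℝ)) (ω : Ω) :
    Set (Fin d → ℝ) :=
  ⋂ ω' ∈ level ψ t ω, ⋃ l ∈ Ioo (0 : ℝ) 1, (l • U ω' + (1 - l) • sharp ψ t U ω)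

/-- The backward iteration defining `W`, indexed from the terminal date. -/
def Wrev {d : ℕ} (ψ : ℕ → Ω → E) (T : ℕ) (V C : ℕ → Ω → Set (Fin d → ℝ)) :
    ℕ → Ω → Set (Fin d → ℝ)
  | 0 => V T
  | (k + 1) => fun ω =>
      V (T - (k + 1)) ω ∩
        (flat ψ (T - (k + 1)) (Wrev ψ T V C k) ω - C (T - (k + 1)) ω)

/-- The sequence `W_t`: `W_T = V_T` and `W_t = V_t ∩ (W_{t+1}^♭ − C_t)` for `t < T`. -/
def W {d : ℕ} (ψ : ℕ → Ω → E) (T : ℕ) (V C : ℕ → Ω → Set (Fin d → ℝ)) (t : ℕ) :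
    Ω → Set (Fin d → ℝ) :=
  Wrev ψ T V C (T - t)

/-- The defining hypotheses of a martingale selection problem `(V, C)`:
adapted measurable correspondences, `V_t(ω)` convex and relatively open,
`C_t(ω)` closed and convex. -/
def IsMSP {d : ℕ} (ψ : ℕ → Ω → E) (T : ℕ) (V C : ℕ → Ω → Set (Fin d → ℝ)) : Prop :=
  ∀ t ≤ T,
    CorrMeasurable (filt ψ t) (V t) ∧ CorrMeasurable (filt ψ t) (C t) ∧
    ∀ ω : Ω, Convex ℝ (V t ω) ∧ V t ω = intrinsicInterior ℝ (V t ω) ∧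
      IsClosed (C t ω) ∧ Convex ℝ (C t ω)

/-- `(ξ, Q)` is a solution of the martingale selection problem `(V, C)`. -/
def IsSolution {d : ℕ} (ψ : ℕ → Ω → E) (T : ℕ) (V C : ℕ → Ω → Set (Fin d → ℝ))
    (ξ : ℕ → Ω → (Fin d → ℝ)) (Q : FinProb Ω) : Prop :=
  (∀ t ≤ T, ξ t ∈ Selections (filt ψ t) (V t)) ∧
  (∀ t, t + 1 ≤ T → ∀ ω ∈ Q.supp, condExp ψ t Q (ξ (t + 1)) ω - ξ t ω ∈ C t ω)

/-- Solvability of the martingale selection problem: a local solution exists at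
every point of `Ω`. -/
def Solvable {d : ℕ} (ψ : ℕ → Ω → E) (T : ℕ) (V C : ℕ → Ω → Set (Fin d → ℝ)) : Prop :=
  ∀ ωb : Ω, ∃ (ξ : ℕ → Ω → (Fin d → ℝ)) (Q : FinProb Ω),
    ωb ∈ Q.supp ∧ IsSolution ψ T V C ξ Q

/-- The positive polar cone of a subset of `ℝ^d`. -/
def polar {d : ℕ} (B : Set (Fin d → ℝ)) : Set (Fin d → ℝ) :=
  {y | ∀ x ∈ B, 0 ≤ ∑ i, y i * x i}

/-- A closed convex cone (containing the origin). -/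
def IsClosedConvexCone {F : Type*} [TopologicalSpace F] [AddCommMonoid F] [Module ℝ F]
    (A : Set F) : Prop :=
  IsClosed A ∧ Convex ℝ A ∧ (0 : F) ∈ A ∧ ∀ c : ℝ, 0 < c → ∀ x ∈ A, c • x ∈ A

end Defs

section LevelSets

variable {Ω E : Type*}

theorem mem_level_self (ψ : ℕ → Ω → E) (t : ℕ) (ω : Ω) : ω ∈ level ψ t ω :=
  fun _ _ => rfl

theorem level_eq_of_mem {ψ : ℕ → Ω → E} {t : ℕ} {ω ω' : Ω} (h : ω' ∈ level ψ t ω) :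
    level ψ t ω' = level ψ t ω := by
  ext x
  exact forall₂_congr fun s hs => by rw [h s hs]

theorem flat_eq_of_mem_level {d : ℕ} {ψ : ℕ → Ω → E} {t : ℕ} (U : Ω → Set (Fin d → ℝ))
    {ω ω' : Ω} (h : ω' ∈ level ψ t ω) : flat ψ t U ω' = flat ψ t U ω := by
  simp only [flat, sharp, level_eq_of_mem h]

theorem measurableSet_level [MeasurableSpace E] [MeasurableSingletonClass E]
    (ψ : ℕ → Ω → E) (t : ℕ) (ω : Ω) : MeasurableSet[natFilt ψ t] (level ψ t ω) := by
  have h : level ψ t ω = ⋂ s ∈ Finset.range (t + 1), ψ s ⁻¹' {ψ s ω} := by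
    ext x
    simp [level]
  rw [h]
  refine @Finset.measurableSet_biInter Ω ℕ (natFilt ψ t) _ _ fun s hs => ?_
  exact le_iSup₂ (f := fun s (_ : s ∈ Finset.range (t + 1)) =>
    MeasurableSpace.comap (ψ s) inferInstance) s hs _ ⟨_, measurableSet_singleton _, rfl⟩

theorem FinProb.meas_eq_zero (Q : FinProb Ω) {A : Set Ω} (h : ∀ ω ∈ Q.supp, ω ∉ A) :
    Q.meas A = 0 := by
  classical
  unfold FinProb.meas
  refine Finset.sum_eq_zero fun ω hω => ?_
  rw [Finset.mem_filter] at hω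
  exact (h ω hω.1 hω.2).elim

/-- Every union of level sets is measurable for the completed filtration. -/
theorem measurableSet_filt_of_saturated [MeasurableSpace E] [MeasurableSingletonClass E]
    {ψ : ℕ → Ω → E} {t : ℕ} {A : Set Ω} (hA : ∀ ω ∈ A, level ψ t ω ⊆ A) :
    MeasurableSet[filt ψ t] A := by
  classical
  rw [filt, MeasurableSpace.measurableSet_iInf]
  intro P
  have union_level_measurable (S : Finset Ω) :
      MeasurableSet[natFilt ψ t] (⋃ ω ∈ S, level ψ t ω) :=
    @Finset.measurableSet_biUnion Ω Ω (natFilt ψ t) _ S fun ω _ => measurableSet_level ψ t ω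
  have hsplit : A = (⋃ ω ∈ P.supp.filter (· ∈ A), level ψ t ω) ∪
      (A \ ⋃ ω ∈ P.supp, level ψ t ω) := by
    ext x
    simp only [mem_union, mem_iUnion, Finset.mem_filter, mem_sdiff, exists_prop]
    constructor
    · intro hx
      by_cases h : ∃ ω ∈ P.supp, x ∈ level ψ t ω
      · obtain ⟨ω, hω, hxω⟩ := h
        exact .inl ⟨ω, ⟨hω, hA x hx (level_eq_of_mem hxω ▸ mem_level_self ψ t ω)⟩, hxω⟩
      · exact .inr ⟨hx, h⟩
    · rintro (⟨ω, ⟨-, hω⟩, hx⟩ | ⟨hx, -⟩)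
      · exact hA ω hω hx
      · exact hx
  rw [hsplit]
  refine MeasurableSet.union (MeasurableSpace.measurableSet_generateFrom
    (.inl (union_level_measurable _))) (MeasurableSpace.measurableSet_generateFrom (.inr ?_))
  refine ⟨(⋃ ω ∈ P.supp, level ψ t ω)ᶜ, fun x hx => hx.2,
    MeasurableSet.compl (union_level_measurable _), P.meas_eq_zero fun ω hω h => h ?_⟩
  exact mem_biUnion (show ω ∈ (P.supp : Set Ω) from hω) (mem_level_self ψ t ω)

end LevelSets

theorem convex_iUnion_Ioo_smul_add_smul {V : Type*} [AddCommGroup V] [Module ℝ V]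
    {A B : Set V} (hA : Convex ℝ A) (hB : Convex ℝ B) :
    Convex ℝ (⋃ l ∈ Ioo (0 : ℝ) 1, (l • A + (1 - l) • B)) := by
  intro x hx y hy a b ha hb hab
  simp only [mem_iUnion, exists_prop, mem_add, mem_smul_set] at hx hy ⊢
  obtain ⟨l, hl, _, ⟨u, hu, rfl⟩, _, ⟨v, hv, rfl⟩, rfl⟩ := hx
  obtain ⟨m, hm, _, ⟨u', hu', rfl⟩, _, ⟨v', hv', rfl⟩, rfl⟩ := hy
  have hk := convex_Ioo (0 : ℝ) 1 hl hm ha hb hab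
  have hk' : (1 : ℝ) - (a • l + b • m) = a * (1 - l) + b * (1 - m) := by
    simp only [smul_eq_mul]
    linear_combination -hab
  have hA' : a • l • u + b • m • u' ∈ (a • l + b • m) • A := by
    simp only [smul_eq_mul]
    rw [hA.add_smul (mul_nonneg ha hl.1.le) (mul_nonneg hb hm.1.le), smul_smul, smul_smul]
    exact add_mem_add (smul_mem_smul_set hu) (smul_mem_smul_set hu')
  have hB' : a • (1 - l) • v + b • (1 - m) • v' ∈ (1 - (a • l + b • m)) • B := by
    rw [hk', hB.add_smul (mul_nonneg ha (sub_nonneg.2 hl.2.le))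
      (mul_nonneg hb (sub_nonneg.2 hm.2.le)), smul_smul, smul_smul]
    exact add_mem_add (smul_mem_smul_set hv) (smul_mem_smul_set hv')
  refine ⟨_, hk, _, hA', _, hB', ?_⟩
  simp only [smul_add]
  abel

/-- A segment from a point of a set to a point of its intrinsic interior can be prolonged
beyond the latter inside the set. -/
theorem exists_pos_add_smul_sub_mem_of_mem_intrinsicInterior {V : Type*}
    [NormedAddCommGroup V] [NormedSpace ℝ V] {s : Set V} {x y : V}
    (hx : x ∈ intrinsicInterior ℝ s) (hy : y ∈ s) : ∃ ε > (0 : ℝ), x + ε • (x - y) ∈ s := by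
  obtain ⟨x, hxi, rfl⟩ := mem_intrinsicInterior.1 hx
  have hmem (ε : ℝ) : (x : V) + ε • ((x : V) - y) ∈ affineSpan ℝ s := by
    have := AffineMap.lineMap_mem (-ε) x.2 (subset_affineSpan ℝ s hy)
    convert this using 1
    simp only [AffineMap.lineMap_apply, vsub_eq_sub, vadd_eq_add]
    module
  let f : ℝ → affineSpan ℝ s := fun ε => ⟨(x : V) + ε • ((x : V) - y), hmem ε⟩
  have hf : Continuous f := by fun_prop
  have hf0 : f 0 = x := by simp [f]
  have hev : ∀ᶠ ε in nhds (0 : ℝ), f ε ∈ interior ((↑) ⁻¹' s : Set (affineSpan ℝ s)) :=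
    hf.continuousAt.eventually_mem (hf0 ▸ isOpen_interior.mem_nhds hxi)
  obtain ⟨ε, hε, hpos⟩ :=
    ((hev.filter_mono nhdsWithin_le_nhds).and (self_mem_nhdsWithin (s := Ioi (0 : ℝ)))).exists
  have hs : f ε ∈ ((↑) ⁻¹' s : Set (affineSpan ℝ s)) := interior_subset hε
  exact ⟨ε, hpos, hs⟩

section Inclusions

variable {Ω E : Type*} {d : ℕ} (ψ : ℕ → Ω → E) (t : ℕ) (U : Ω → Set (Fin d → ℝ))

theorem subset_sharp {ω ω' : Ω} (h : ω' ∈ level ψ t ω) : U ω' ⊆ sharp ψ t U ω :=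
  (subset_biUnion_of_mem (u := U) h).trans (subset_convexHull ℝ _)

theorem flat_subset_sharp (ω : Ω) : flat ψ t U ω ⊆ sharp ψ t U ω := by
  intro x hx
  have hx' := mem_iInter₂.1 hx ω (mem_level_self ψ t ω)
  simp only [mem_iUnion, exists_prop, mem_add, mem_smul_set] at hx'
  obtain ⟨l, hl, _, ⟨u, hu, rfl⟩, _, ⟨v, hv, rfl⟩, rfl⟩ := hx'
  exact convex_convexHull ℝ _ (subset_sharp ψ t U (mem_level_self ψ t ω) hu) hv hl.1.le
    (sub_nonneg.2 hl.2.le) (add_sub_cancel _ _)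

theorem intrinsicInterior_sharp_subset_flat {ω : Ω}
    (hne : ∀ ω' ∈ level ψ t ω, (U ω').Nonempty) :
    intrinsicInterior ℝ (sharp ψ t U ω) ⊆ flat ψ t U ω := by
  intro x hx
  refine mem_iInter₂.2 fun ω' hω' => ?_
  obtain ⟨y, hy⟩ := hne ω' hω'
  obtain ⟨ε, hε, hz⟩ := exists_pos_add_smul_sub_mem_of_mem_intrinsicInterior hx
    (subset_sharp ψ t U hω' hy)
  simp only [mem_iUnion, exists_prop]
  refine ⟨ε / (1 + ε), ⟨by positivity, (div_lt_one (by positivity)).2 (by linarith)⟩, ?_⟩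
  refine mem_add.2 ⟨_, smul_mem_smul_set hy, _, smul_mem_smul_set hz, ?_⟩
  ext i
  simp only [Pi.add_apply, Pi.smul_apply, Pi.sub_apply, smul_eq_mul]
  field_simp
  ring

end Inclusions

/-- Lemma 3.3 and (3.5): `U^♭` is `F_t`-measurable and convex valued, and
`ri U^♯ ⊆ U^♭ ⊆ U^♯` wherever `U` is nonempty on the level set. -/
theorem flat_measurable_convex_and_inclusions
    {Ω E : Type*}
    [TopologicalSpace Ω] [PolishSpace Ω] [MeasurableSpace Ω] [BorelSpace Ω]
    [MetricSpace E] [TopologicalSpace.SeparableSpace E] [MeasurableSpace E] [BorelSpace E]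
    (ψ : ℕ → Ω → E) (hψ : ∀ t, Measurable (ψ t)) (hψ0 : ∃ e : E, ∀ ω, ψ 0 ω = e)
    (d T t : ℕ) (ht : t < T)
    (U : Ω → Set (Fin d → ℝ)) (hU : CorrMeasurable (filt ψ (t + 1)) U)
    (hUconv : ∀ ω : Ω, Convex ℝ (U ω)) :
    CorrMeasurable (filt ψ t) (flat ψ t U) ∧ (∀ ω : Ω, Convex ℝ (flat ψ t U ω)) ∧
    ∀ ω : Ω, (∀ ω' ∈ level ψ t ω, (U ω').Nonempty) →
      intrinsicInterior ℝ (sharp ψ t U ω) ⊆ flat ψ t U ω ∧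
      flat ψ t U ω ⊆ sharp ψ t U ω := by
  refine ⟨fun O _ => measurableSet_filt_of_saturated fun ω hω ω' hω' => ?_, fun ω => ?_,
    fun ω hne => ⟨intrinsicInterior_sharp_subset_flat ψ t U hne, flat_subset_sharp ψ t U ω⟩⟩
  · rw [mem_ofPred_eq, flat_eq_of_mem_level U hω']
    exact hω
  · exact convex_iInter₂ fun ω' _ =>
      convex_iUnion_Ioo_smul_add_smul (hUconv ω') (convex_convexHull ℝ _)

end MSPPaper
end

section
/- Let t ∈ I ∖ {T} and let U : Ω ⇒ ℝ^d be an F_{t+1}-measurable correspondence with open values. Then U^♯ has open values; if moreover U(ω) ≠ ∅ for every ω ∈ Ω, then U^♭(ω) = U^♯(ω) for every ω ∈ Ω. -/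
open Set MeasureTheory Pointwise

namespace MSPPaper

/-- Every point of an open set `S` is a strict convex combination of any given point and a
point of `S`. -/
theorem subset_iUnion_smul_add_smul {F : Type*} [AddCommGroup F] [Module ℝ F]
    [TopologicalSpace F] [IsTopologicalAddGroup F] [ContinuousSMul ℝ F] {A S : Set F}
    (hS : IsOpen S) (hA : A.Nonempty) :
    S ⊆ ⋃ l ∈ Ioo (0 : ℝ) 1, (l • A + (1 - l) • S) := by
  intro y hy
  obtain ⟨u, hu⟩ := hA
  have hcont : ContinuousAt (fun l : ℝ => (1 - l)⁻¹ • (y - l • u)) 0 :=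
    ContinuousAt.smul (ContinuousAt.inv₀ (by fun_prop) (by norm_num)) (by fun_prop)
  have hev : ∀ᶠ l : ℝ in nhds 0, (1 - l)⁻¹ • (y - l • u) ∈ S :=
    hcont.eventually (hS.mem_nhds (by simpa using hy))
  obtain ⟨l, hlS, hl⟩ := ((hev.filter_mono nhdsWithin_le_nhds).and
    (Ioo_mem_nhdsGT (zero_lt_one' ℝ))).exists
  have hne : 1 - l ≠ 0 := (sub_pos.2 hl.2).ne'
  refine mem_iUnion₂.2 ⟨l, hl, l • u, smul_mem_smul_set hu, _, smul_mem_smul_set hlS, ?_⟩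
  simp only [smul_inv_smul₀ hne, add_sub_cancel]

/-- Convex combinations of points of a convex set `S` stay in `S`. -/
theorem iUnion_smul_add_smul_subset {F : Type*} [AddCommGroup F] [Module ℝ F]
    {A S : Set F} (hS : Convex ℝ S) (hA : A ⊆ S) :
    ⋃ l ∈ Ioo (0 : ℝ) 1, (l • A + (1 - l) • S) ⊆ S :=
  iUnion₂_subset fun l hl => (add_subset_add_right (smul_set_mono hA)).trans <|
    convex_iff_pointwise_add_subset.1 hS hl.1.le (sub_nonneg.2 hl.2.le) (add_sub_cancel l 1)

/-- Lemma 3.5: if `U` has open values then `U^♯` has open values, and (for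
nonempty `U`) `U^♭ = U^♯`. -/
theorem sharp_open_and_flat_eq_sharp
    {Ω E : Type*}
    [TopologicalSpace Ω] [PolishSpace Ω] [MeasurableSpace Ω] [BorelSpace Ω]
    [MetricSpace E] [TopologicalSpace.SeparableSpace E] [MeasurableSpace E] [BorelSpace E]
    (ψ : ℕ → Ω → E) (hψ : ∀ t, Measurable (ψ t)) (hψ0 : ∃ e : E, ∀ ω, ψ 0 ω = e)
    (d T t : ℕ) (ht : t < T)
    (U : Ω → Set (Fin d → ℝ)) (hU : CorrMeasurable (filt ψ (t + 1)) U)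
    (hUopen : ∀ ω : Ω, IsOpen (U ω)) :
    (∀ ω : Ω, IsOpen (sharp ψ t U ω)) ∧
    ((∀ ω : Ω, (U ω).Nonempty) → ∀ ω : Ω, flat ψ t U ω = sharp ψ t U ω) := by
  have hopen : ∀ ω, IsOpen (sharp ψ t U ω) := fun ω =>
    (isOpen_biUnion fun ω' _ => hUopen ω').convexHull
  refine ⟨hopen, fun hne ω => Subset.antisymm ?_ ?_⟩
  · have hω : ω ∈ level ψ t ω := fun _ _ => rfl
    have hU_sub : U ω ⊆ sharp ψ t U ω :=
      (subset_biUnion_of_mem (u := U) hω).trans (subset_convexHull ℝ _)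
    exact (biInter_subset_of_mem hω).trans <|
      iUnion_smul_add_smul_subset (convex_convexHull ℝ _) hU_sub
  · exact subset_iInter₂ fun ω' _ => subset_iUnion_smul_add_smul (hopen ω) (hne ω')

end MSPPaper
end

section
/- Let t ∈ I ∖ {T} and let U : Ω ⇒ ℝ^d be an F_{t+1}-measurable correspondence whose values are nonempty, convex and relatively open (U(ω) = ri U(ω) for every ω). Then U^♭(ω) = ri U^♯(ω) for every ω ∈ Ω; in particular, U^♭ has relatively open values. -/
open Set MeasureTheory Pointwise

namespace MSPPaper

section RelativeInterior

variable {V : Type*} [NormedAddCommGroup V] [NormedSpace ℝ V] {K : Set V} {x y : V}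

/-- From a point of the relative interior, segments starting in the set can be prolonged. -/
theorem exists_mem_openSegment_of_mem_intrinsicInterior
    (hx : x ∈ intrinsicInterior ℝ K) (hy : y ∈ K) : ∃ z ∈ K, x ∈ openSegment ℝ y z := by
  obtain ⟨p, hp, rfl⟩ := mem_intrinsicInterior.1 hx
  let g : ℝ → affineSpan ℝ K := fun r =>
    ⟨AffineMap.lineMap y (p : V) r, AffineMap.lineMap_mem r (subset_affineSpan ℝ K hy) p.2⟩
  have hg : Continuous g := AffineMap.lineMap_continuous.subtype_mk _
  have hg1 : g 1 = p := by simp [g]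
  have hev : ∀ᶠ r in nhds (1 : ℝ), (g r : V) ∈ K :=
    hg.continuousAt (hg1.symm ▸ mem_interior_iff_mem_nhds.1 hp)
  obtain ⟨r, hr, hrK⟩ := ((hev.filter_mono nhdsWithin_le_nhds).and
    (self_mem_nhdsWithin : Ioi (1 : ℝ) ∈ nhdsWithin 1 (Ioi 1))).exists.imp fun _ h => h.symm
  have hr : 1 < r := hr
  have hr0 : 0 < r := by linarith
  refine ⟨_, hrK, 1 - r⁻¹, r⁻¹, by simpa using inv_lt_one_of_one_lt₀ hr, by positivity,
    by ring, ?_⟩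
  simp only [g, AffineMap.lineMap_apply_module]
  match_scalars <;> field_simp
  ring

/-- The points from which a segment can be prolonged inside a convex set form a convex set. -/
theorem convex_setOf_exists_mem_openSegment (hK : Convex ℝ K) (x : V) :
    Convex ℝ {y | ∃ z ∈ K, x ∈ openSegment ℝ y z} := by
  rintro y₁ ⟨z₁, hz₁, a₁, b₁, ha₁, hb₁, h₁, rfl⟩ y₂ ⟨z₂, hz₂, a₂, b₂, ha₂, hb₂, h₂, he⟩
    c₁ c₂ hc₁ hc₂ hc
  have hpos : ∀ u v : ℝ, 0 < u → 0 < v → 0 < c₁ * u + c₂ * v := fun u v hu hv => by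
    rcases hc₁.eq_or_lt with rfl | h
    · have : c₂ = 1 := by linarith
      simpa [this] using hv
    · positivity
  have hD := hpos a₂ a₁ ha₂ ha₁
  have hN := hpos (a₂ * b₁) (a₁ * b₂) (by positivity) (by positivity)
  set D := c₁ * a₂ + c₂ * a₁ with hDdef
  set N := c₁ * (a₂ * b₁) + c₂ * (a₁ * b₂) with hNdef
  refine ⟨(c₁ * (a₂ * b₁) / N) • z₁ + (c₂ * (a₁ * b₂) / N) • z₂,
    hK hz₁ hz₂ (by positivity) (by positivity) (by rw [← add_div, ← hNdef, div_self hN.ne']),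
    a₁ * a₂ / D, N / D, by positivity, by positivity, ?_, ?_⟩
  · rw [← add_div, div_eq_one_iff_eq hD.ne']
    linear_combination c₁ * a₂ * h₁ + c₂ * a₁ * h₂ - a₁ * a₂ * hc
  · have key : (c₁ * a₂ / D) • (a₁ • y₁ + b₁ • z₁) + (c₂ * a₁ / D) • (a₂ • y₂ + b₂ • z₂) =
        a₁ • y₁ + b₁ • z₁ := by
      rw [he, ← add_smul, ← add_div, ← hDdef, div_self hD.ne', one_smul]
    rw [← key]
    match_scalars <;> field_simp

/-- A point on an open segment issued from a relative interior point of a subset `S` of `K`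
allows one to prolong, inside `K`, segments starting in `S`. -/
theorem exists_mem_openSegment_of_subset {S : Set V} (hK : Convex ℝ K) (hS : S ⊆ K) {u s : V}
    (hu : u ∈ intrinsicInterior ℝ S) (hs : s ∈ K) (hx : x ∈ openSegment ℝ u s) (hy : y ∈ S) :
    ∃ z ∈ K, x ∈ openSegment ℝ y z := by
  obtain ⟨v, hv, a, b, ha, hb, hab, rfl⟩ := exists_mem_openSegment_of_mem_intrinsicInterior hu hy
  obtain ⟨l, m, hl, hm, hlm, rfl⟩ := hx
  have hN : 0 < l * b + m := by positivity
  refine ⟨(l * b / (l * b + m)) • v + (m / (l * b + m)) • s,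
    hK (hS hv) hs (by positivity) (by positivity) (by rw [← add_div, div_self hN.ne']),
    l * a, l * b + m, by positivity, hN, by linear_combination l * hab + hlm, ?_⟩
  match_scalars <;> field_simp

variable [FiniteDimensional ℝ V]

/-- A point of a convex set is in its relative interior as soon as all segments ending at this
point can be prolonged. -/
theorem mem_intrinsicInterior_of_forall_exists_mem_openSegment (hK : Convex ℝ K) (hne : K.Nonempty)
    (h : ∀ y ∈ K, ∃ z ∈ K, x ∈ openSegment ℝ y z) : x ∈ intrinsicInterior ℝ K := by
  obtain ⟨y, hy⟩ := hne.intrinsicInterior hK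
  obtain ⟨w, hw, hx⟩ := h y (intrinsicInterior_subset hy)
  have hxK : x ∈ K := hK.openSegment_subset (intrinsicInterior_subset hy) hw hx
  obtain ⟨a, b, ha, hb, hab, hxe⟩ := hx
  obtain ⟨q, hq, rfl⟩ := mem_intrinsicInterior.1 hy
  let g : affineSpan ℝ K → affineSpan ℝ K := fun p =>
    ⟨AffineMap.lineMap w (p : V) a⁻¹, AffineMap.lineMap_mem _ (subset_affineSpan ℝ K hw) p.2⟩
  have hg : Continuous g := by
    refine Continuous.subtype_mk ?_ _
    simp only [AffineMap.lineMap_apply_module]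
    fun_prop
  let p : affineSpan ℝ K := ⟨x, subset_affineSpan ℝ K hxK⟩
  have hgp : g p = q := by
    obtain rfl : b = 1 - a := by linarith
    ext1
    simp only [g, p, AffineMap.lineMap_apply_module, ← hxe]
    match_scalars <;> field_simp
    ring
  have hev : ∀ᶠ p' in nhds p, (g p' : V) ∈ K :=
    hg.continuousAt (hgp.symm ▸ mem_interior_iff_mem_nhds.1 hq)
  refine mem_intrinsicInterior.2 ⟨p, mem_interior_iff_mem_nhds.2 ?_, rfl⟩
  filter_upwards [hev] with p' hp'
  rw [mem_preimage]
  convert hK hp' hw ha.le hb.le hab using 1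
  obtain rfl : b = 1 - a := by linarith
  simp only [g, AffineMap.lineMap_apply_module]
  match_scalars <;> field_simp
  ring

/-- The relative interior of a convex set is relatively open. -/
theorem intrinsicInterior_intrinsicInterior (hK : Convex ℝ K) :
    intrinsicInterior ℝ (intrinsicInterior ℝ K) = intrinsicInterior ℝ K := by
  refine intrinsicInterior_subset.antisymm fun x hx => ?_
  have hmid : ∀ {u s z : V}, u ∈ intrinsicInterior ℝ K → s ∈ K → z ∈ openSegment ℝ u s →
      z ∈ intrinsicInterior ℝ K := fun hu hs hz =>
    mem_intrinsicInterior_of_forall_exists_mem_openSegment hK ⟨_, hs⟩ fun _ hy =>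
      exists_mem_openSegment_of_subset hK Subset.rfl hu hs hz hy
  refine mem_intrinsicInterior_of_forall_exists_mem_openSegment ?_ ⟨x, hx⟩ fun y hy => ?_
  · exact convex_iff_openSegment_subset.2 fun u hu s hs _ hz =>
      hmid hu (intrinsicInterior_subset hs) hz
  · obtain ⟨z, hz, a, b, ha, hb, hab, rfl⟩ :=
      exists_mem_openSegment_of_mem_intrinsicInterior hx (intrinsicInterior_subset hy)
    refine ⟨_, hmid hx hz ⟨1 / 2, 1 / 2, by norm_num, by norm_num, by norm_num, rfl⟩,
      a / (1 + b), 2 * b / (1 + b), by positivity, by positivity, ?_, ?_⟩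
    · field_simp
      linear_combination hab
    · obtain rfl : a = 1 - b := by linarith
      match_scalars <;> field_simp
      ring

end RelativeInterior

/-- Lemma 3.6: if `U` has nonempty, convex, relatively open values then
`U^♭ = ri U^♯`; in particular `U^♭` has relatively open values. -/
theorem flat_eq_ri_sharp
    {Ω E : Type*}
    [TopologicalSpace Ω] [PolishSpace Ω] [MeasurableSpace Ω] [BorelSpace Ω]
    [MetricSpace E] [TopologicalSpace.SeparableSpace E] [MeasurableSpace E] [BorelSpace E]
    (ψ : ℕ → Ω → E) (hψ : ∀ t, Measurable (ψ t)) (hψ0 : ∃ e : E, ∀ ω, ψ 0 ω = e)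
    (d T t : ℕ) (ht : t < T)
    (U : Ω → Set (Fin d → ℝ)) (hU : CorrMeasurable (filt ψ (t + 1)) U)
    (hUne : ∀ ω : Ω, (U ω).Nonempty) (hUconv : ∀ ω : Ω, Convex ℝ (U ω))
    (hUro : ∀ ω : Ω, U ω = intrinsicInterior ℝ (U ω)) :
    (∀ ω : Ω, flat ψ t U ω = intrinsicInterior ℝ (sharp ψ t U ω)) ∧
    (∀ ω : Ω, flat ψ t U ω = intrinsicInterior ℝ (flat ψ t U ω)) := by
  have hsharp : ∀ ω, Convex ℝ (sharp ψ t U ω) := fun ω => convex_convexHull ℝ _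
  have hsub : ∀ ω, ∀ ω' ∈ level ψ t ω, U ω' ⊆ sharp ψ t U ω := fun ω ω' h =>
    (subset_biUnion_of_mem (u := U) h).trans (subset_convexHull ℝ _)
  have hself : ∀ ω, ω ∈ level ψ t ω := fun ω s _ => rfl
  have hflat : ∀ ω x, x ∈ flat ψ t U ω ↔
      ∀ ω' ∈ level ψ t ω, ∃ u ∈ U ω', ∃ s ∈ sharp ψ t U ω, x ∈ openSegment ℝ u s := by
    intro ω x
    simp only [flat, mem_iInter, mem_iUnion, mem_add, mem_smul_set]
    refine forall₂_congr fun ω' _ => ⟨?_, ?_⟩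
    · rintro ⟨l, hl, _, ⟨u, hu, rfl⟩, _, ⟨s, hs, rfl⟩, rfl⟩
      exact ⟨u, hu, s, hs, l, 1 - l, hl.1, sub_pos.2 hl.2, by ring, rfl⟩
    · rintro ⟨u, hu, s, hs, a, b, ha, hb, hab, rfl⟩
      obtain rfl : b = 1 - a := by linarith
      exact ⟨a, ⟨ha, by linarith⟩, _, ⟨u, hu, rfl⟩, _, ⟨s, hs, rfl⟩, rfl⟩
  have hmain : ∀ ω, flat ψ t U ω = intrinsicInterior ℝ (sharp ψ t U ω) := by
    intro ω
    ext x
    rw [hflat]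
    constructor
    · intro hx
      refine mem_intrinsicInterior_of_forall_exists_mem_openSegment (hsharp ω)
        ((hUne ω).mono (hsub ω ω (hself ω))) ?_
      refine convexHull_min (iUnion₂_subset fun ω' hω' y hy => ?_)
        (convex_setOf_exists_mem_openSegment (hsharp ω) x)
      obtain ⟨u, hu, s, hs, hxs⟩ := hx ω' hω'
      exact exists_mem_openSegment_of_subset (hsharp ω) (hsub ω ω' hω') (hUro ω' ▸ hu) hs hxs hy
    · intro hx ω' hω'
      obtain ⟨u, hu⟩ := hUne ω'
      exact ⟨u, hu, exists_mem_openSegment_of_mem_intrinsicInterior hx (hsub ω ω' hω' hu)⟩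
  refine ⟨hmain, fun ω => ?_⟩
  rw [hmain, intrinsicInterior_intrinsicInterior (hsharp ω)]

end MSPPaper
end
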